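/- (Cohomological equation for Diophantine rotations) Let α ∈ ℝ be Diophantine and δ > 0. Suppose c̃ : ℝ → ℝ is 1-periodic and extends to a holomorphic function on the strip {z : |Im z| < δ}, and set c = ∫₀¹ c̃(ω) dω. Then there exists a 1-periodic function b : ℝ → ℝ, extending holomorphically to the strip {z : |Im z| < δ}, such that b(ω + α) − b(ω) = c̃(ω) − c for every ω ∈ ℝ. -/

import Mathlib

/-- A function `f : ℝ → ℝ` extends to a holomorphic function on the strip
`{z : |Im z| < δ}`. -/
def ExtendsHoloStrip (f : ℝ → ℝ) (δ : ℝ) : Prop :=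
  ∃ F : ℂ → ℂ, DifferentiableOn ℂ F {z : ℂ | |z.im| < δ} ∧ ∀ x : ℝ, F x = (f x : ℂ)

/-- An irrational `α` is Diophantine if there are `c > 0` and `r > 1` with
`|sin(2πnα)| > c/|n|^r` for every nonzero integer `n`. -/
def IsDiophantine (α : ℝ) : Prop :=
  Irrational α ∧ ∃ c > (0 : ℝ), ∃ r > (1 : ℝ),
    ∀ n : ℤ, n ≠ 0 → c / |(n : ℝ)| ^ r < |Real.sin (2 * Real.pi * n * α)|

section Strip

theorem isOpen_strip (δ : ℝ) : IsOpen {z : ℂ | |z.im| < δ} :=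
  isOpen_lt (continuous_abs.comp Complex.continuous_im) continuous_const

theorem isPreconnected_strip (δ : ℝ) : IsPreconnected {z : ℂ | |z.im| < δ} := by
  have h : {z : ℂ | |z.im| < δ} = Complex.imLm ⁻¹' Set.Ioo (-δ) δ := by
    ext z; simp [abs_lt]
  rw [h]
  exact ((convex_Ioo (-δ) δ).linear_preimage Complex.imLm).isPreconnected

/-- A holomorphic function on a strip that is 1-periodic on the real line is 1-periodic. -/
theorem strip_periodic_of_real_periodic {F : ℂ → ℂ} {δ : ℝ} (hδ : 0 < δ)
    (hF : DifferentiableOn ℂ F {z : ℂ | |z.im| < δ}) (hper : ∀ x : ℝ, F (x + 1) = F x)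
    {z : ℂ} (hz : |z.im| < δ) : F (z + 1) = F z := by
  have hG : DifferentiableOn ℂ (fun z => F (z + 1)) {z : ℂ | |z.im| < δ} :=
    hF.comp (by fun_prop) fun w hw => by simpa using hw
  refine (hG.analyticOnNhd (isOpen_strip δ)).eqOn_of_preconnected_of_frequently_eq
    (hF.analyticOnNhd (isOpen_strip δ)) (isPreconnected_strip δ) (z₀ := 0) (by simpa using hδ) ?_ hz
  have ht : Filter.Tendsto ((↑) : ℝ → ℂ) (nhdsWithin 0 {0}ᶜ) (nhdsWithin 0 {0}ᶜ) := by
    refine tendsto_nhdsWithin_iff.2 ⟨?_, ?_⟩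
    · exact (Complex.continuous_ofReal.tendsto' 0 0 (by simp)).mono_left nhdsWithin_le_nhds
    · filter_upwards [self_mem_nhdsWithin] with x hx
      simpa using hx
  exact ht.frequently (Filter.Eventually.of_forall hper).frequently

/-- The integral of a 1-periodic holomorphic function over a period may be shifted vertically
inside the strip of holomorphy. -/
theorem strip_integral_shift {G : ℂ → ℂ} {δ η : ℝ}
    (hG : DifferentiableOn ℂ G {z : ℂ | |z.im| < δ})
    (hper : ∀ z : ℂ, |z.im| < δ → G (z + 1) = G z) (hη : |η| < δ) :
    ∫ x in (0 : ℝ)..1, G x = ∫ x in (0 : ℝ)..1, G (x + η * Complex.I) := by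
  have hle : ∀ y ∈ Set.uIcc 0 η, |y| < δ := fun y hy =>
    lt_of_le_of_lt (by simpa using Set.abs_sub_left_of_mem_uIcc hy) hη
  have h := Complex.integral_boundary_rect_eq_zero_of_differentiableOn G 0 (1 + η * Complex.I)
    (hG.mono fun z hz => hle z.im (by simpa using (Complex.mem_reProdIm.1 hz).2))
  have hv : ∫ y in (0 : ℝ)..η, G (1 + y * Complex.I) = ∫ y in (0 : ℝ)..η, G (y * Complex.I) :=
    intervalIntegral.integral_congr fun y hy => by
      have := hper (y * Complex.I) (by simpa using hle y hy)
      simpa [add_comm] using this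
  simp only [Complex.zero_re, Complex.zero_im, Complex.add_re, Complex.one_re, Complex.mul_re,
    Complex.ofReal_re, Complex.I_re, mul_zero, Complex.ofReal_im, Complex.I_im, mul_one, sub_self,
    add_zero, Complex.add_im, Complex.one_im, Complex.mul_im, zero_add, Complex.ofReal_zero,
    zero_mul, Complex.ofReal_one, hv, add_sub_cancel_right] at h
  exact sub_eq_zero.1 h

theorem norm_exp_two_pi_I_mul (n : ℤ) (z : ℂ) :
    ‖Complex.exp (2 * Real.pi * Complex.I * n * z)‖ = Real.exp (-(2 * Real.pi * n * z.im)) := by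
  rw [Complex.norm_exp]
  congr 1
  simp [Complex.mul_re, Complex.mul_im]

theorem exp_two_pi_I_mul_add_one (n : ℤ) (z : ℂ) :
    Complex.exp (2 * Real.pi * Complex.I * n * (z + 1)) =
      Complex.exp (2 * Real.pi * Complex.I * n * z) := by
  rw [mul_add, mul_one, Complex.exp_add, show (2 * Real.pi * Complex.I * n : ℂ) =
    n * (2 * Real.pi * Complex.I) by ring, Complex.exp_int_mul_two_pi_mul_I, mul_one]

/-- Exponential decay of the Fourier coefficients of a 1-periodic holomorphic function on a
strip. -/
theorem exists_norm_fourier_integral_le {F : ℂ → ℂ} {δ η : ℝ}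
    (hF : DifferentiableOn ℂ F {z : ℂ | |z.im| < δ})
    (hper : ∀ z : ℂ, |z.im| < δ → F (z + 1) = F z) (hη₀ : 0 ≤ η) (hη : η < δ) :
    ∃ M : ℝ, 0 ≤ M ∧ ∀ n : ℤ,
      ‖∫ x in (0 : ℝ)..1, Complex.exp (2 * Real.pi * Complex.I * (-n : ℤ) * x) * F x‖ ≤
        M * Real.exp (-(2 * Real.pi * η * |(n : ℝ)|)) := by
  have hK : IsCompact (Set.Icc (0 : ℝ) 1 ×ℂ Set.Icc (-η) η) := isCompact_Icc.reProdIm isCompact_Icc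
  obtain ⟨M, hM⟩ := hK.exists_bound_of_continuousOn (hF.continuousOn.mono fun z hz =>
    (abs_le.2 (Complex.mem_reProdIm.1 hz).2).trans_lt hη)
  have hM₀ : 0 ≤ M := (norm_nonneg _).trans
    (hM 0 (by simp [Complex.mem_reProdIm, hη₀]))
  have key : ∀ (n : ℤ) (y : ℝ), |y| ≤ η →
      ‖∫ x in (0 : ℝ)..1, Complex.exp (2 * Real.pi * Complex.I * (-n : ℤ) * x) * F x‖ ≤
        M * Real.exp (2 * Real.pi * n * y) := by
    intro n y hy
    rw [strip_integral_shift
      (G := fun z => Complex.exp (2 * Real.pi * Complex.I * (-n : ℤ) * z) * F z)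
      (DifferentiableOn.mul (by fun_prop) hF)
      (fun z hz => by rw [exp_two_pi_I_mul_add_one, hper z hz]) (hy.trans_lt hη)]
    have := intervalIntegral.norm_integral_le_of_norm_le_const (a := 0) (b := 1)
      (f := fun x : ℝ => Complex.exp (2 * Real.pi * Complex.I * (-n : ℤ) * (x + y * Complex.I)) *
        F (x + y * Complex.I)) (C := M * Real.exp (2 * Real.pi * n * y)) fun x hx => by
      rw [Set.uIoc_of_le zero_le_one] at hx
      rw [norm_mul, norm_exp_two_pi_I_mul, mul_comm]
      gcongr
      · exact hM _ (by simpa [Complex.mem_reProdIm] using ⟨⟨hx.1.le, hx.2⟩, abs_le.1 hy⟩)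
      · simp
    simpa using this
  refine ⟨M, hM₀, fun n => ?_⟩
  rcases le_total 0 n with hn | hn
  · convert key n (-η) (by simp [abs_of_nonneg hη₀]) using 3
    rw [abs_of_nonneg (by exact_mod_cast hn)]; ring
  · convert key n η (by simp [abs_of_nonneg hη₀]) using 3
    rw [abs_of_nonpos (by exact_mod_cast hn)]; ring

end Strip

theorem summable_int_rpow_mul_exp_neg (r : ℝ) {a : ℝ} (ha : 0 < a) :
    Summable fun n : ℤ => |(n : ℝ)| ^ r * Real.exp (-(a * |(n : ℝ)|)) := by
  have h : Summable fun n : ℕ => (n : ℝ) ^ r * Real.exp (-(a * n)) := by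
    have h₁ := Real.summable_pow_mul_exp_neg_nat_mul ⌈r⌉₊ ha
    rw [← summable_nat_add_iff 1] at h₁ ⊢
    refine h₁.of_nonneg_of_le (fun n => by positivity) fun n => ?_
    rw [neg_mul]
    gcongr
    rw [← Real.rpow_natCast]
    exact Real.rpow_le_rpow_of_exponent_le (by simp) (Nat.le_ceil r)
  refine Summable.of_nat_of_neg ?_ ?_ <;> simpa using h

theorem abs_sin_le_norm_exp_sub_one (θ : ℝ) :
    |Real.sin θ| ≤ ‖Complex.exp (Complex.I * θ) - 1‖ := by
  refine le_trans ?_ (Complex.abs_im_le_norm _)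
  rw [mul_comm, Complex.sub_im, Complex.exp_ofReal_mul_I_im]
  simp

/-- A continuous 1-periodic function with absolutely summable Fourier coefficients is the sum of
its Fourier series. -/
theorem hasSum_fourier_of_periodic {f : ℝ → ℂ} (hf : Continuous f) (hper : Function.Periodic f 1)
    (hs : Summable fun n : ℤ =>
      ∫ x in (0 : ℝ)..1, Complex.exp (2 * Real.pi * Complex.I * (-n : ℤ) * x) * f x) (x : ℝ) :
    HasSum (fun n : ℤ =>
      (∫ x in (0 : ℝ)..1, Complex.exp (2 * Real.pi * Complex.I * (-n : ℤ) * x) * f x) *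
        Complex.exp (2 * Real.pi * Complex.I * n * x)) (f x) := by
  let g : C(AddCircle (1 : ℝ), ℂ) := ⟨hper.lift, continuous_coinduced_dom.2 hf⟩
  have hc : ∀ n : ℤ, fourierCoeff g n =
      ∫ x in (0 : ℝ)..1, Complex.exp (2 * Real.pi * Complex.I * (-n : ℤ) * x) * f x := fun n => by
    rw [fourierCoeff_eq_intervalIntegral g n 0]
    simp only [fourier_coe_apply, zero_add, div_one, one_smul, Complex.ofReal_one, smul_eq_mul]
    rfl
  have h := has_pointwise_sum_fourier_series_of_summable (f := g) (by simpa only [← hc] using hs) x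
  simp only [hc, fourier_coe_apply, smul_eq_mul, Complex.ofReal_one, div_one] at h
  exact h

/-- A Fourier series whose coefficients are `O(|n| ^ r * exp (-2πη|n|))` for every `η < δ` converges
absolutely on the strip of half-width `δ`, and its sum is holomorphic there. -/
theorem strip_fourier_series_holomorphic {d : ℤ → ℂ} {δ r : ℝ}
    (hd : ∀ η : ℝ, 0 ≤ η → η < δ → ∃ M : ℝ, 0 ≤ M ∧ ∀ n : ℤ,
      ‖d n‖ ≤ M * (|(n : ℝ)| ^ r * Real.exp (-(2 * Real.pi * η * |(n : ℝ)|)))) :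
    (∀ z : ℂ, |z.im| < δ →
      Summable fun n : ℤ => d n * Complex.exp (2 * Real.pi * Complex.I * n * z)) ∧
    DifferentiableOn ℂ (fun z => ∑' n : ℤ, d n * Complex.exp (2 * Real.pi * Complex.I * n * z))
      {z : ℂ | |z.im| < δ} := by
  have key : ∀ η₁ : ℝ, 0 ≤ η₁ → η₁ < δ → ∃ u : ℤ → ℝ, Summable u ∧
      ∀ (n : ℤ) (z : ℂ), z ∈ {z : ℂ | |z.im| < η₁} →
        ‖d n * Complex.exp (2 * Real.pi * Complex.I * n * z)‖ ≤ u n := by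
    intro η₁ h₀ h₁
    obtain ⟨η₂, h₁₂, h₂⟩ := exists_between h₁
    obtain ⟨M, hM₀, hM⟩ := hd η₂ (h₀.trans h₁₂.le) h₂
    refine ⟨_, (summable_int_rpow_mul_exp_neg r
      (a := 2 * Real.pi * (η₂ - η₁)) (by have := sub_pos.2 h₁₂; positivity)).mul_left M, ?_⟩
    intro n z hz
    rw [norm_mul, norm_exp_two_pi_I_mul]
    have hexp : -(2 * Real.pi * n * z.im) ≤ 2 * Real.pi * η₁ * |(n : ℝ)| := by
      have h₃ : -((n : ℝ) * z.im) ≤ |(n : ℝ)| * η₁ :=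
        (neg_le_abs _).trans (by rw [abs_mul]; gcongr; exact le_of_lt hz)
      nlinarith [mul_le_mul_of_nonneg_left h₃ Real.two_pi_pos.le]
    calc ‖d n‖ * Real.exp (-(2 * Real.pi * n * z.im))
        ≤ M * (|(n : ℝ)| ^ r * Real.exp (-(2 * Real.pi * η₂ * |(n : ℝ)|))) *
            Real.exp (2 * Real.pi * η₁ * |(n : ℝ)|) := by gcongr; exact hM n
      _ = M * (|(n : ℝ)| ^ r * Real.exp (-(2 * Real.pi * (η₂ - η₁) * |(n : ℝ)|))) := by
          rw [mul_assoc, mul_assoc, ← Real.exp_add]; congr 3; ring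
  constructor
  · intro z hz
    obtain ⟨η, hzη, hη⟩ := exists_between hz
    obtain ⟨u, hu, hle⟩ := key η ((abs_nonneg _).trans hzη.le) hη
    exact hu.of_norm_bounded fun n => hle n z hzη
  · intro z hz
    obtain ⟨η, hzη, hη⟩ := exists_between (show |z.im| < δ from hz)
    obtain ⟨u, hu, hle⟩ := key η ((abs_nonneg _).trans hzη.le) hη
    exact ((Complex.differentiableOn_tsum_of_summable_norm hu (fun n => by fun_prop)
      (isOpen_strip η) hle).differentiableAt
        ((isOpen_strip η).mem_nhds hzη)).differentiableWithinAt

/-- The real part, on the real line, of a holomorphic function on a strip extends holomorphically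
to the same strip. -/
theorem extendsHoloStrip_re {B : ℂ → ℂ} {δ : ℝ}
    (hB : DifferentiableOn ℂ B {z : ℂ | |z.im| < δ}) :
    ExtendsHoloStrip (fun x => (B x).re) δ := by
  refine ⟨fun z => (B z + starRingEnd ℂ (B (starRingEnd ℂ z))) / 2, ?_, fun x => ?_⟩
  · intro z hz
    have hz' : starRingEnd ℂ z ∈ {z : ℂ | |z.im| < δ} := by simpa using hz
    have h₁ := hB.differentiableAt ((isOpen_strip δ).mem_nhds hz)
    have h₂ := (hB.differentiableAt ((isOpen_strip δ).mem_nhds hz')).conj_conj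
    rw [Complex.conj_conj] at h₂
    exact ((h₁.add h₂).div_const 2).differentiableWithinAt
  · simp only [Complex.conj_ofReal, Complex.re_eq_add_conj]

/-- Cohomological equation for Diophantine rotations: if `c̃ : ℝ → ℝ` is 1-periodic and
extends holomorphically to the strip `{|Im z| < δ}`, and `c = ∫₀¹ c̃`, then there is a
1-periodic `b : ℝ → ℝ`, holomorphically extendable to the same strip, with
`b(ω + α) − b(ω) = c̃(ω) − c` for every `ω`. -/
theorem cohomological_equation (α δ : ℝ) (hα : IsDiophantine α) (hδ : 0 < δ)
    (ct : ℝ → ℝ) (hctper : ∀ ω : ℝ, ct (ω + 1) = ct ω)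
    (hcthol : ExtendsHoloStrip ct δ) :
    ∃ b : ℝ → ℝ, (∀ ω : ℝ, b (ω + 1) = b ω) ∧ ExtendsHoloStrip b δ ∧
      ∀ ω : ℝ, b (ω + α) - b ω = ct ω - ∫ x in (0:ℝ)..1, ct x := by
  obtain ⟨-, c, hc, r, hr, hdio⟩ := hα
  obtain ⟨F, hF, hFct⟩ := hcthol
  have hFper : ∀ z : ℂ, |z.im| < δ → F (z + 1) = F z := fun z hz =>
    strip_periodic_of_real_periodic hδ hF (fun x => by
      have := hFct (x + 1)
      rw [hctper, ← hFct x] at this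
      simpa using this) hz
  have hreal : ∀ x : ℝ, |(x : ℂ).im| < δ := fun x => by simpa using hδ
  have hcont : Continuous fun x : ℝ => F x :=
    hF.continuousOn.comp_continuous Complex.continuous_ofReal hreal
  set a : ℤ → ℂ := fun n =>
    ∫ x in (0 : ℝ)..1, Complex.exp (2 * Real.pi * Complex.I * (-n : ℤ) * x) * F x with ha
  have ha_le : ∀ η : ℝ, 0 ≤ η → η < δ → ∃ M : ℝ, 0 ≤ M ∧ ∀ n : ℤ,
      ‖a n‖ ≤ M * Real.exp (-(2 * Real.pi * η * |(n : ℝ)|)) := fun η h₀ h₁ =>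
    exists_norm_fourier_integral_le hF hFper h₀ h₁
  have ha_sum : Summable a := by
    obtain ⟨M, -, hM⟩ := ha_le (δ / 2) (by positivity) (by linarith)
    refine Summable.of_norm_bounded ?_ hM
    simpa using (summable_int_rpow_mul_exp_neg 0
      (a := 2 * Real.pi * (δ / 2)) (by positivity)).mul_left M
  have hsum : ∀ x : ℝ, HasSum (fun n : ℤ =>
      a n * Complex.exp (2 * Real.pi * Complex.I * n * x)) (F x) := fun x =>
    hasSum_fourier_of_periodic hcont
      (fun x => by simpa using hFper x (hreal x)) ha_sum x
  have ha_zero : a 0 = ((∫ x in (0 : ℝ)..1, ct x : ℝ) : ℂ) := by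
    rw [← intervalIntegral.integral_ofReal]
    simp [ha, hFct]
  set e : ℤ → ℂ := fun n => Complex.exp (2 * Real.pi * Complex.I * n * α) - 1 with he
  have he_le : ∀ n : ℤ, n ≠ 0 → c / |(n : ℝ)| ^ r < ‖e n‖ := fun n hn => by
    refine (hdio n hn).trans_le ((abs_sin_le_norm_exp_sub_one _).trans_eq ?_)
    simp only [he]
    congr 3
    push_cast
    ring
  have he_zero : e 0 = 0 := by simp [he]
  have he_ne : ∀ n : ℤ, n ≠ 0 → e n ≠ 0 := fun n hn =>
    norm_pos_iff.1 (lt_of_le_of_lt (by positivity) (he_le n hn))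
  have hd : ∀ η : ℝ, 0 ≤ η → η < δ → ∃ M : ℝ, 0 ≤ M ∧ ∀ n : ℤ, ‖a n / e n‖ ≤
      M * (|(n : ℝ)| ^ r * Real.exp (-(2 * Real.pi * η * |(n : ℝ)|))) := by
    intro η h₀ h₁
    obtain ⟨M, hM₀, hM⟩ := ha_le η h₀ h₁
    refine ⟨M / c, by positivity, fun n => ?_⟩
    rcases eq_or_ne n 0 with rfl | hn
    · rw [he_zero, div_zero, norm_zero]
      positivity
    · have hn' : 0 < |(n : ℝ)| ^ r := Real.rpow_pos_of_pos (by simpa using hn) r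
      rw [norm_div]
      calc ‖a n‖ / ‖e n‖
          ≤ M * Real.exp (-(2 * Real.pi * η * |(n : ℝ)|)) / (c / |(n : ℝ)| ^ r) := by
            gcongr
            · exact hM n
            · exact (he_le n hn).le
        _ = _ := by field_simp
  obtain ⟨hBsum, hBhol⟩ := strip_fourier_series_holomorphic hd
  refine ⟨_, fun ω => ?_, extendsHoloStrip_re hBhol, fun ω => ?_⟩
  · simp only [Complex.ofReal_add, Complex.ofReal_one, exp_two_pi_I_mul_add_one]
  · have h₁ := (hBsum _ (hreal (ω + α))).hasSum.sub (hBsum _ (hreal ω)).hasSum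
    have h₂ := (hsum ω).sub (hasSum_ite_eq (0 : ℤ) (a 0))
    have h₃ := h₁.unique (h₂.congr_fun fun n => ?_)
    · rw [← Complex.sub_re, h₃, hFct, ha_zero]
      simp
    · rcases eq_or_ne n 0 with rfl | hn
      · simp [he_zero]
      · have := he_ne n hn
        rw [if_neg hn, sub_zero, ← mul_sub, Complex.ofReal_add, mul_add, Complex.exp_add,
          ← mul_sub_one, div_mul_eq_mul_div, div_eq_iff this]
        simp only [he]
        ring
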